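/- arXiv:2411.13305 — 2 statements merged into one kernel-verified Lean document; each statement's English description precedes it below -/
import Mathlib

section
/- Let (Ω, ℱ, ℙ) be a probability space and let Q : Ω → ℂ^{N_r×N_t} be a random matrix whose entries are integrable with integrable pairwise products and satisfy E[[Q]_{i,j} · conj([Q]_{k,l})] = 1/N_t if (i,j) = (k,l) and 0 otherwise. Let R ∈ ℂ^{N_r×N_r}, T ∈ ℂ^{N_t×N_t} be deterministic matrices and N ∈ ℝ^{N_r×N_t} a deterministic matrix with nonnegative entries, and set G̃ = R (N ⊙ Q) T†, where ⊙ is the entrywise (Hadamard) product. Then for every deterministic Hermitian C̃ ∈ ℂ^{N_r×N_r}, the entrywise expectation satisfies E[G̃† C̃ G̃] = (1/N_t) T Π(C̃) T†, where Π(C̃) is the N_t×N_t diagonal matrix with [Π(C̃)]_{i,i} = Σ_{j=1}^{N_r} ([N]_{j,i})² [R† C̃ R]_{j,j}. -/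
open Matrix MeasureTheory

/-- Entrywise expansion of the quadratic form `G† C G` for `G = R (N ⊙ Q) T†`. -/
lemma conjTranspose_mul_mul_hadamard_apply {m n : Type*} [Fintype m] [Fintype n]
    (R C : Matrix m m ℂ) (T : Matrix n n ℂ) (N : Matrix m n ℝ) (Q : Matrix m n ℂ) (a b : n) :
    ((R * Matrix.hadamard (N.map Complex.ofReal) Q * Tᴴ)ᴴ * C *
        (R * Matrix.hadamard (N.map Complex.ofReal) Q * Tᴴ)) a b
      = ∑ q, ∑ i, ∑ k, ∑ p,
          (T a p * N k p * (Rᴴ * C * R) k i * N i q * (starRingEnd ℂ) (T b q)) *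
            (Q i q * (starRingEnd ℂ) (Q k p)) := by
  generalize hX : Matrix.hadamard (N.map Complex.ofReal) Q = X
  have h : (R * X * Tᴴ)ᴴ * C * (R * X * Tᴴ) = T * Xᴴ * (Rᴴ * C * R) * X * Tᴴ := by
    simp only [conjTranspose_mul, conjTranspose_conjTranspose, Matrix.mul_assoc]
  rw [h]
  generalize Rᴴ * C * R = M
  subst hX
  simp only [mul_apply, Finset.sum_mul, conjTranspose_apply, hadamard_apply, map_apply,
    star_mul', RCLike.star_def, Complex.conj_ofReal]
  refine Finset.sum_congr rfl fun q _ => Finset.sum_congr rfl fun i _ =>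
    Finset.sum_congr rfl fun k _ => Finset.sum_congr rfl fun p _ => ?_
  ring

/-- For the Weichselberger random component `G̃ = R (N ⊙ Q) T†`, where the
entries of `Q` are uncorrelated with variance `1/N_t`, and any deterministic Hermitian
`C̃ ∈ ℂ^{N_r×N_r}`, the entrywise expectation satisfies
`E[G̃† C̃ G̃] = (1/N_t) T Π(C̃) T†` with `[Π(C̃)]_{i,i} = Σ_j ([N]_{j,i})² [R† C̃ R]_{j,j}`. -/
theorem stmt_6 {Nr Nt : ℕ} {Ω : Type*} [MeasurableSpace Ω]
    (μ : Measure Ω) [IsProbabilityMeasure μ]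
    (Q : Ω → Matrix (Fin Nr) (Fin Nt) ℂ)
    (hQint : ∀ i j, Integrable (fun ω => Q ω i j) μ)
    (hQint2 : ∀ i j k l, Integrable (fun ω => Q ω i j * (starRingEnd ℂ) (Q ω k l)) μ)
    (hQcov : ∀ i j k l,
      (∫ ω, Q ω i j * (starRingEnd ℂ) (Q ω k l) ∂μ)
        = if i = k ∧ j = l then (Nt : ℂ)⁻¹ else 0)
    (R : Matrix (Fin Nr) (Fin Nr) ℂ) (T : Matrix (Fin Nt) (Fin Nt) ℂ)
    (N : Matrix (Fin Nr) (Fin Nt) ℝ) (hN : ∀ i j, 0 ≤ N i j)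
    (C : Matrix (Fin Nr) (Fin Nr) ℂ) (hC : C.IsHermitian) :
    ∀ a b : Fin Nt,
      (∫ ω, ((R * Matrix.hadamard (N.map Complex.ofReal) (Q ω) * Tᴴ)ᴴ * C *
              (R * Matrix.hadamard (N.map Complex.ofReal) (Q ω) * Tᴴ)) a b ∂μ)
        = ((Nt : ℂ)⁻¹ •
            (T * Matrix.diagonal (fun i => ∑ j, ((N j i : ℂ)) ^ 2 * (Rᴴ * C * R) j j) * Tᴴ))
            a b := by
  intro a b
  have hint (q i k p) := (hQint2 i q k p).const_mul
    (T a p * N k p * (Rᴴ * C * R) k i * N i q * (starRingEnd ℂ) (T b q))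
  simp_rw [conjTranspose_mul_mul_hadamard_apply]
  rw [integral_finsetSum _ fun q _ => integrable_finsetSum _ fun i _ =>
    integrable_finsetSum _ fun k _ => integrable_finsetSum _ fun p _ => hint q i k p]
  rw [Matrix.smul_apply, mul_apply, smul_eq_mul, Finset.mul_sum]
  refine Finset.sum_congr rfl fun q _ => ?_
  rw [integral_finsetSum _ fun i _ =>
    integrable_finsetSum _ fun k _ => integrable_finsetSum _ fun p _ => hint q i k p]
  rw [mul_diagonal, conjTranspose_apply, Finset.mul_sum, Finset.sum_mul, Finset.mul_sum]
  refine Finset.sum_congr rfl fun i _ => ?_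
  rw [integral_finsetSum _ fun k _ => integrable_finsetSum _ fun p _ => hint q i k p]
  simp_rw [integral_finsetSum _ fun p _ => hint q i _ p, integral_const_mul, hQcov]
  rw [Finset.sum_eq_single i (fun k _ hk => by simp [hk.symm]) (by simp),
    Finset.sum_eq_single q (fun p _ hp => by simp [hp.symm]) (by simp)]
  simp only [and_self, if_true, RCLike.star_def]
  ring
end

section
/- Let (Ω, ℱ, ℙ) be a probability space and let Q : Ω → ℂ^{N_r×N_t} be a random matrix whose entries are integrable with integrable pairwise products and satisfy E[[Q]_{i,j} · conj([Q]_{k,l})] = 1/N_t if (i,j) = (k,l) and 0 otherwise. Let R ∈ ℂ^{N_r×N_r}, T ∈ ℂ^{N_t×N_t} be deterministic matrices and N ∈ ℝ^{N_r×N_t} a deterministic matrix with nonnegative entries, and set G̃ = R (N ⊙ Q) T†, where ⊙ is the entrywise (Hadamard) product. Then for every deterministic Hermitian C ∈ ℂ^{N_t×N_t}, the entrywise expectation satisfies E[G̃ C G̃†] = (1/N_t) R Π̃(C) R†, where Π̃(C) is the N_r×N_r diagonal matrix with [Π̃(C)]_{i,i} = Σ_{j=1}^{N_t} ([N]_{i,j})²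 [T† C T]_{j,j}. -/
open Matrix MeasureTheory

theorem Matrix.mul_mul_apply_eq_sum {l m n o α : Type*} [Fintype m] [Fintype n]
    [NonUnitalSemiring α] (A : Matrix l m α) (B : Matrix m n α) (C : Matrix n o α) (a : l) (b : o) :
    (A * B * C) a b = ∑ p : m × n, A a p.1 * B p.1 p.2 * C p.2 b := by
  simp only [Matrix.mul_apply, Finset.sum_mul, Fintype.sum_prod_type]
  exact Finset.sum_comm

/-- If the entries of `Q` are uncorrelated with variance `v`, then the `(i, k)` entry of
`(W ⊙ Q) S (W ⊙ Q)ᴴ` is integrable, and the expectation of the matrix is diagonal. -/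
theorem hadamard_mul_mul_conjTranspose_integrable_and_integral {m n Ω : Type*} [Fintype n]
    [DecidableEq m] [DecidableEq n] [MeasurableSpace Ω] {μ : Measure Ω}
    {Q : Ω → Matrix m n ℂ} {v : ℂ}
    (hQint : ∀ i j k l, Integrable (fun ω => Q ω i j * (starRingEnd ℂ) (Q ω k l)) μ)
    (hQcov : ∀ i j k l,
      (∫ ω, Q ω i j * (starRingEnd ℂ) (Q ω k l) ∂μ) = if i = k ∧ j = l then v else 0)
    (W : Matrix m n ℂ) (S : Matrix n n ℂ) (i k : m) :
    Integrable (fun ω => (W.hadamard (Q ω) * S * (W.hadamard (Q ω))ᴴ) i k) μ ∧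
      (∫ ω, (W.hadamard (Q ω) * S * (W.hadamard (Q ω))ᴴ) i k ∂μ)
        = Matrix.diagonal (fun i => v * ∑ j, W i j * star (W i j) * S j j) i k := by
  have h (ω : Ω) : (W.hadamard (Q ω) * S * (W.hadamard (Q ω))ᴴ) i k
      = ∑ p : n × n, W i p.1 * S p.1 p.2 * star (W k p.2) *
          (Q ω i p.1 * (starRingEnd ℂ) (Q ω k p.2)) := by
    rw [Matrix.mul_mul_apply_eq_sum]
    refine Finset.sum_congr rfl fun p _ => ?_
    simp only [hadamard_apply, conjTranspose_apply, star_mul, starRingEnd_apply]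
    ring
  have hint (p : n × n) : Integrable (fun ω => W i p.1 * S p.1 p.2 * star (W k p.2) *
      (Q ω i p.1 * (starRingEnd ℂ) (Q ω k p.2))) μ := (hQint _ _ _ _).const_mul _
  simp only [h]
  refine ⟨integrable_finsetSum _ fun p _ => hint p, ?_⟩
  rw [integral_finsetSum _ fun p _ => hint p]
  simp only [integral_const_mul, hQcov, Fintype.sum_prod_type]
  by_cases hik : i = k
  · subst hik
    simp only [true_and, mul_ite, mul_zero, Finset.sum_ite_eq, Finset.mem_univ, if_true,
      diagonal_apply_eq, Finset.mul_sum]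
    exact Finset.sum_congr rfl fun j _ => by ring
  · simp [hik]

/-- For the Weichselberger random component `G̃ = R (N ⊙ Q) T†`, where the
entries of `Q` are uncorrelated with variance `1/N_t`, and any deterministic Hermitian
`C ∈ ℂ^{N_t×N_t}`, the entrywise expectation satisfies
`E[G̃ C G̃†] = (1/N_t) R Π̃(C) R†` with `[Π̃(C)]_{i,i} = Σ_j ([N]_{i,j})² [T† C T]_{j,j}`. -/
theorem stmt_7 {Nr Nt : ℕ} {Ω : Type*} [MeasurableSpace Ω]
    (μ : Measure Ω) [IsProbabilityMeasure μ]
    (Q : Ω → Matrix (Fin Nr) (Fin Nt) ℂ)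
    (hQint : ∀ i j, Integrable (fun ω => Q ω i j) μ)
    (hQint2 : ∀ i j k l, Integrable (fun ω => Q ω i j * (starRingEnd ℂ) (Q ω k l)) μ)
    (hQcov : ∀ i j k l,
      (∫ ω, Q ω i j * (starRingEnd ℂ) (Q ω k l) ∂μ)
        = if i = k ∧ j = l then (Nt : ℂ)⁻¹ else 0)
    (R : Matrix (Fin Nr) (Fin Nr) ℂ) (T : Matrix (Fin Nt) (Fin Nt) ℂ)
    (N : Matrix (Fin Nr) (Fin Nt) ℝ) (hN : ∀ i j, 0 ≤ N i j)
    (C : Matrix (Fin Nt) (Fin Nt) ℂ) (hC : C.IsHermitian) :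
    ∀ a b : Fin Nr,
      (∫ ω, ((R * Matrix.hadamard (N.map Complex.ofReal) (Q ω) * Tᴴ) * C *
              (R * Matrix.hadamard (N.map Complex.ofReal) (Q ω) * Tᴴ)ᴴ) a b ∂μ)
        = ((Nt : ℂ)⁻¹ •
            (R * Matrix.diagonal (fun i => ∑ j, ((N i j : ℂ)) ^ 2 * (Tᴴ * C * T) j j) * Rᴴ))
            a b := by
  intro a b
  set W : Matrix (Fin Nr) (Fin Nt) ℂ := N.map Complex.ofReal with hW
  have h (ω : Ω) : (R * W.hadamard (Q ω) * Tᴴ) * C * (R * W.hadamard (Q ω) * Tᴴ)ᴴ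
      = R * (W.hadamard (Q ω) * (Tᴴ * C * T) * (W.hadamard (Q ω))ᴴ) * Rᴴ := by
    simp only [conjTranspose_mul, conjTranspose_conjTranspose, Matrix.mul_assoc]
  have key := hadamard_mul_mul_conjTranspose_integrable_and_integral hQint2 hQcov W (Tᴴ * C * T)
  have hdiag : Matrix.diagonal
        (fun i => (Nt : ℂ)⁻¹ * ∑ j, W i j * star (W i j) * (Tᴴ * C * T) j j)
      = (Nt : ℂ)⁻¹ • Matrix.diagonal (fun i => ∑ j, ((N i j : ℂ)) ^ 2 * (Tᴴ * C * T) j j) := by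
    rw [← diagonal_smul]
    congr 1
    ext i
    simp [hW, pow_two]
  have hint (p : Fin Nr × Fin Nr) := ((key p.1 p.2).1.const_mul (R a p.1)).mul_const (Rᴴ p.2 b)
  rw [← Matrix.smul_mul, ← Matrix.mul_smul, ← hdiag, Matrix.mul_mul_apply_eq_sum]
  simp only [h, Matrix.mul_mul_apply_eq_sum R _ Rᴴ]
  rw [integral_finsetSum _ fun p _ => hint p]
  refine Finset.sum_congr rfl fun p _ => ?_
  rw [integral_mul_const, integral_const_mul, (key p.1 p.2).2]
end
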